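/- Let n ≥ 2 be an integer, let σ be a finite Borel measure on ℝⁿ with compact support, let ν : ℝⁿ → ℝⁿ be Borel measurable with ‖ν(y)‖ ≤ 1 for all y, and let ψ ∈ L¹(σ). Then the double layer potential w[ψ](x) = −∫ ψ(y) (ν(y)·∇S_n(x−y)) dσ(y) is well defined and infinitely differentiable at every point x ∈ ℝⁿ ∖ supp σ, and it is harmonic on the open set ℝⁿ ∖ supp σ. -/

import Mathlib

open MeasureTheory Metric Filter Topology

noncomputable section

/-- The `(n-1)`-dimensional Hausdorff measure of the unit sphere of `ℝⁿ`. -/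
def sphereArea (n : ℕ) : ℝ :=
  (MeasureTheory.Measure.hausdorffMeasure ((n : ℝ) - 1)
    (Metric.sphere (0 : EuclideanSpace ℝ (Fin n)) 1)).toReal

/-- The fundamental solution of the Laplace operator in `ℝⁿ`. -/
def fundSol (n : ℕ) (ξ : EuclideanSpace ℝ (Fin n)) : ℝ :=
  if n = 2 then (1 / (2 * Real.pi)) * Real.log ‖ξ‖
  else ‖ξ‖ ^ ((2 : ℝ) - n) / (((2 : ℝ) - n) * sphereArea n)

/-- The support of a measure: the smallest closed set whose complement is null. -/
def measSupport {E : Type*} [TopologicalSpace E] [MeasurableSpace E]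
    (σ : MeasureTheory.Measure E) : Set E :=
  ⋂₀ {C : Set E | IsClosed C ∧ σ Cᶜ = 0}

/-- Partial derivative in the `i`-th coordinate direction. -/
def pderivE {n : ℕ} (i : Fin n) (f : EuclideanSpace ℝ (Fin n) → ℝ) :
    EuclideanSpace ℝ (Fin n) → ℝ :=
  fun x => fderiv ℝ f x (EuclideanSpace.single i 1)

/-- Iterated partial derivative `D^η` associated with the multi-index `η`. -/
def mderiv {n : ℕ} (η : Fin n → ℕ) (f : EuclideanSpace ℝ (Fin n) → ℝ) :
    EuclideanSpace ℝ (Fin n) → ℝ :=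
  ((List.ofFn fun i : Fin n => (pderivE i)^[η i]).foldr (fun g h => g ∘ h) id) f

/-- `f` is harmonic on `U`: twice continuously differentiable on `U` with vanishing
Laplacian on `U`. -/
def HarmonicOnSet {n : ℕ} (f : EuclideanSpace ℝ (Fin n) → ℝ)
    (U : Set (EuclideanSpace ℝ (Fin n))) : Prop :=
  ContDiffOn ℝ 2 f U ∧ ∀ x ∈ U, (∑ i : Fin n, pderivE i (pderivE i f) x) = 0

theorem measure_compl_measSupport {E : Type*} [TopologicalSpace E] [SecondCountableTopology E]
    [MeasurableSpace E] (σ : Measure E) : σ (measSupport σ)ᶜ = 0 := by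
  obtain ⟨T, hTc, hTS, hT⟩ := TopologicalSpace.isOpen_sUnion_countable
    {U : Set E | IsOpen U ∧ σ U = 0} (fun U hU => hU.1)
  have h : (measSupport σ)ᶜ = ⋃₀ {U : Set E | IsOpen U ∧ σ U = 0} := by
    ext x
    simp only [measSupport, Set.mem_compl_iff, Set.mem_sInter, Set.mem_sUnion, Set.mem_ofPred_eq,
      not_forall]
    constructor
    · rintro ⟨C, ⟨hC, hC0⟩, hx⟩
      exact ⟨Cᶜ, ⟨hC.isOpen_compl, hC0⟩, hx⟩
    · rintro ⟨U, ⟨hU, hU0⟩, hx⟩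
      exact ⟨Uᶜ, ⟨hU.isClosed_compl, by rwa [compl_compl]⟩, fun h => h hx⟩
  rw [h, ← hT]
  exact (measure_sUnion_null_iff hTc).2 fun U hU => (hTS hU).2

section Potential

variable {E : Type} [NormedAddCommGroup E] {W : Type} [NormedAddCommGroup W] {K : Set E} {f : E → W}

theorem exists_ball_kernel_bound [ProperSpace E] (hK : IsCompact K) (hf : ContinuousOn f {0}ᶜ) {x : E}
    (hx : x ∉ K) :
    ∃ δ > 0, ∃ C, ∀ z ∈ ball x δ, z ∉ K ∧ ∀ y ∈ K, ‖f (z - y)‖ ≤ C := by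
  obtain ⟨δ, hδ, hsub⟩ := nhds_basis_closedBall.mem_iff.1 (hK.isClosed.isOpen_compl.mem_nhds hx)
  obtain ⟨C, hC⟩ := ((isCompact_closedBall x δ).prod hK).exists_bound_of_continuousOn
    (f := fun p : E × E => f (p.1 - p.2)) <| hf.comp (by fun_prop) fun p hp h0 =>
      hsub hp.1 (by rw [sub_eq_zero.1 h0]; exact hp.2)
  exact ⟨δ, hδ, C, fun z hz => ⟨hsub (ball_subset_closedBall hz),
    fun y hy => hC (z, y) ⟨ball_subset_closedBall hz, hy⟩⟩⟩

variable [MeasurableSpace E] [BorelSpace E] [SecondCountableTopology E] {σ : Measure E} {φ : E → ℝ}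

theorem aestronglyMeasurable_potential_kernel (hK : IsCompact K) (hσ : σ Kᶜ = 0)
    (hf : ContinuousOn f {0}ᶜ) {x : E} (hx : x ∉ K) :
    AEStronglyMeasurable (fun y => f (x - y)) σ := by
  have h : ContinuousOn (fun y => f (x - y)) K :=
    hf.comp (by fun_prop) fun y hy h0 => hx (by rwa [sub_eq_zero.1 h0])
  have := h.aestronglyMeasurable (μ := σ) hK.measurableSet
  rwa [Measure.restrict_eq_self_of_ae_mem (ae_iff.2 hσ)] at this

variable [ProperSpace E] [NormedSpace ℝ W]

theorem integrable_potential (hK : IsCompact K) (hσ : σ Kᶜ = 0) (hφ : Integrable φ σ)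
    (hf : ContinuousOn f {0}ᶜ) {x : E} (hx : x ∉ K) :
    Integrable (fun y => φ y • f (x - y)) σ := by
  obtain ⟨δ, hδ, C, hC⟩ := exists_ball_kernel_bound hK hf hx
  refine (hφ.norm.mul_const C).mono'
    (hφ.1.smul (aestronglyMeasurable_potential_kernel hK hσ hf hx)) ?_
  filter_upwards [ae_iff.2 hσ] with y hy
  rw [norm_smul]
  gcongr
  exact (hC x (mem_ball_self hδ)).2 y hy

variable [NormedSpace ℝ E]

theorem hasFDerivAt_potential (hK : IsCompact K) (hσ : σ Kᶜ = 0) (hφ : Integrable φ σ)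
    (hf : ContDiffOn ℝ 1 f {0}ᶜ) {x : E} (hx : x ∉ K) :
    HasFDerivAt (fun z => ∫ y, φ y • f (z - y) ∂σ) (∫ y, φ y • fderiv ℝ f (x - y) ∂σ) x := by
  have hf' : ContinuousOn (fderiv ℝ f) {0}ᶜ :=
    hf.continuousOn_fderiv_of_isOpen isOpen_compl_singleton le_rfl
  obtain ⟨δ, hδ, C, hC⟩ := exists_ball_kernel_bound hK hf' hx
  refine hasFDerivAt_integral_of_dominated_of_fderiv_le (bound := fun y => ‖φ y‖ * C)
    (F' := fun z y => φ y • fderiv ℝ f (z - y)) (ball_mem_nhds x hδ) ?_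
    (integrable_potential hK hσ hφ hf.continuousOn hx)
    (integrable_potential hK hσ hφ hf' hx).1 ?_ (hφ.norm.mul_const C) ?_
  · filter_upwards [ball_mem_nhds x hδ] with z hz
    exact (integrable_potential hK hσ hφ hf.continuousOn (hC z hz).1).1
  · filter_upwards [ae_iff.2 hσ] with y hy z hz
    rw [norm_smul]
    gcongr
    exact (hC z hz).2 y hy
  · filter_upwards [ae_iff.2 hσ] with y hy z hz
    have h0 : z - y ∈ ({0}ᶜ : Set E) := fun h => (hC z hz).1 (by rwa [sub_eq_zero.1 h])
    have hd := ((hf.differentiableOn one_ne_zero).differentiableAt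
      (isOpen_compl_singleton.mem_nhds h0)).hasFDerivAt
    have := (hd.comp z ((hasFDerivAt_id z).sub_const y)).const_smul (φ y)
    rw [ContinuousLinearMap.comp_id] at this
    exact this

theorem contDiffOn_potential (hK : IsCompact K) (hσ : σ Kᶜ = 0) (hφ : Integrable φ σ)
    (hf : ContDiffOn ℝ (⊤ : ℕ∞) f {0}ᶜ) :
    ContDiffOn ℝ (⊤ : ℕ∞) (fun z => ∫ y, φ y • f (z - y) ∂σ) Kᶜ := by
  refine contDiffOn_infty.2 fun n => ?_
  have hd : ∀ {W : Type} [NormedAddCommGroup W] [NormedSpace ℝ W] {f : E → W},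
      ContDiffOn ℝ (⊤ : ℕ∞) f {0}ᶜ → ∀ x ∈ Kᶜ, HasFDerivAt (fun z => ∫ y, φ y • f (z - y) ∂σ)
        (∫ y, φ y • fderiv ℝ f (x - y) ∂σ) x := fun hf x hx =>
    hasFDerivAt_potential hK hσ hφ (hf.of_le (by exact_mod_cast le_top)) hx
  induction n generalizing W with
  | zero =>
    exact contDiffOn_zero.2 fun x hx => (hd hf x hx).continuousAt.continuousWithinAt
  | succ n ih =>
    have ho := hK.isClosed.isOpen_compl
    push_cast
    refine (contDiffOn_succ_iff_fderiv_of_isOpen ho).2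
      ⟨fun x hx => (hd hf x hx).differentiableAt.differentiableWithinAt, by simp, ?_⟩
    exact (ih (hf.fderiv_of_isOpen isOpen_compl_singleton (by simp))).congr
      fun x hx => (hd hf x hx).fderiv

end Potential

section PartialDerivatives

variable {n : ℕ} {f g : EuclideanSpace ℝ (Fin n) → ℝ} {U : Set (EuclideanSpace ℝ (Fin n))}

theorem ContDiffOn.pderivE (hU : IsOpen U) (hf : ContDiffOn ℝ (⊤ : ℕ∞) f U) (i : Fin n) :
    ContDiffOn ℝ (⊤ : ℕ∞) (pderivE i f) U :=
  (hf.fderiv_of_isOpen hU (by simp)).clm_apply contDiffOn_const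

theorem Set.EqOn.pderivE (hU : IsOpen U) (h : Set.EqOn f g U) (i : Fin n) :
    Set.EqOn (pderivE i f) (pderivE i g) U := fun x hx => by
  simp only [_root_.pderivE, (h.eventuallyEq_of_mem (hU.mem_nhds hx)).fderiv_eq]

theorem pderivE_comm (hU : IsOpen U) (hf : ContDiffOn ℝ (⊤ : ℕ∞) f U) (i j : Fin n) :
    Set.EqOn (pderivE i (pderivE j f)) (pderivE j (pderivE i f)) U := by
  intro x hx
  have hc : ContDiffAt ℝ (⊤ : ℕ∞) f x := hf.contDiffAt (hU.mem_nhds hx)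
  have hd : DifferentiableAt ℝ (fderiv ℝ f) x :=
    (((hf.fderiv_of_isOpen hU (m := (⊤ : ℕ∞)) (by simp)).differentiableOn (by simp)).differentiableAt
      (hU.mem_nhds hx))
  have key : ∀ a b : Fin n, pderivE a (pderivE b f) x =
      fderiv ℝ (fderiv ℝ f) x (EuclideanSpace.single a 1) (EuclideanSpace.single b 1) := by
    intro a b
    have := (hd.hasFDerivAt.clm_apply
      (hasFDerivAt_const (EuclideanSpace.single b (1 : ℝ)) x)).fderiv
    refine (DFunLike.congr_fun this _).trans ?_
    simp
  rw [key, key]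
  exact hc.isSymmSndFDerivAt (by
    rw [minSmoothness_of_isRCLikeNormedField]
    exact WithTop.coe_le_coe.2 (le_top : (2 : ℕ∞) ≤ ⊤)) _ _

theorem fderiv_apply_eq_sum_pderivE (f : EuclideanSpace ℝ (Fin n) → ℝ)
    (x v : EuclideanSpace ℝ (Fin n)) : fderiv ℝ f x v = ∑ j, v j * pderivE j f x := by
  conv_lhs => rw [← (EuclideanSpace.basisFun (Fin n) ℝ).sum_repr v]
  simp [pderivE, map_sum]

theorem pderivE_sum {ι : Type*} (s : Finset ι) {F : ι → EuclideanSpace ℝ (Fin n) → ℝ}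
    {x : EuclideanSpace ℝ (Fin n)} (hF : ∀ j ∈ s, DifferentiableAt ℝ (F j) x) (i : Fin n) :
    pderivE i (fun z => ∑ j ∈ s, F j z) x = ∑ j ∈ s, pderivE i (F j) x := by
  simp [pderivE, fderiv_fun_sum hF]

theorem pderivE_potential {σ : Measure (EuclideanSpace ℝ (Fin n))}
    {K : Set (EuclideanSpace ℝ (Fin n))} {φ : EuclideanSpace ℝ (Fin n) → ℝ}
    (hK : IsCompact K) (hσ : σ Kᶜ = 0) (hφ : Integrable φ σ)
    (hf : ContDiffOn ℝ (⊤ : ℕ∞) f {0}ᶜ) (i : Fin n) :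
    Set.EqOn (pderivE i fun z => ∫ y, φ y • f (z - y) ∂σ)
      (fun z => ∫ y, φ y • pderivE i f (z - y) ∂σ) Kᶜ := by
  intro x hx
  have h1 : ContDiffOn ℝ 1 f {0}ᶜ := hf.of_le (by exact_mod_cast le_top)
  have hf' : ContinuousOn (fderiv ℝ f) {0}ᶜ :=
    h1.continuousOn_fderiv_of_isOpen isOpen_compl_singleton le_rfl
  simp only [pderivE, (hasFDerivAt_potential hK hσ hφ h1 hx).fderiv]
  rw [ContinuousLinearMap.integral_apply (integrable_potential hK hσ hφ hf' hx)]
  rfl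

end PartialDerivatives

section FundamentalSolution

variable {n : ℕ}

theorem contDiffOn_fundSol (n : ℕ) : ContDiffOn ℝ (⊤ : ℕ∞) (fundSol n) {0}ᶜ := by
  intro x hx
  have hx0 : x ≠ 0 := hx
  have hn : ContDiffAt ℝ (⊤ : ℕ∞) (fun ξ : EuclideanSpace ℝ (Fin n) => ‖ξ‖) x :=
    contDiffAt_norm ℝ hx0
  refine ContDiffAt.contDiffWithinAt ?_
  unfold fundSol
  split_ifs
  · exact contDiffAt_const.mul (hn.log (norm_ne_zero_iff.2 hx0))
  · exact (hn.rpow_const_of_ne (norm_ne_zero_iff.2 hx0)).div_const _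

theorem exists_pderivE_fundSol (hn : 2 ≤ n) : ∃ c : ℝ, ∀ i : Fin n,
    Set.EqOn (pderivE i (fundSol n)) (fun x => c * (x i * (‖x‖ ^ 2) ^ (-(n : ℝ) / 2))) {0}ᶜ := by
  have hs : ∀ x : EuclideanSpace ℝ (Fin n),
      HasFDerivAt (fun ξ : EuclideanSpace ℝ (Fin n) => ‖ξ‖ ^ 2) (2 • innerSL ℝ x) x :=
    fun x => (hasStrictFDerivAt_norm_sq x).hasFDerivAt
  by_cases h2 : n = 2
  · subst h2
    refine ⟨1 / (2 * Real.pi), fun i x hx => ?_⟩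
    have hpos : 0 < ‖x‖ ^ 2 := by have : 0 < ‖x‖ := norm_pos_iff.2 hx
                                  positivity
    have hS : fundSol 2 = fun ξ => (1 / (4 * Real.pi)) * Real.log (‖ξ‖ ^ 2) := by
      funext ξ
      simp only [fundSol, if_true, Real.log_pow]
      push_cast
      field_simp
      ring
    have := (((hs x).log hpos.ne').const_mul (1 / (4 * Real.pi))).fderiv
    rw [hS]
    simp only [pderivE, this]
    have he : (-((2 : ℕ) : ℝ) / 2) = -1 := by norm_num
    rw [he, Real.rpow_neg_one]
    simp [EuclideanSpace.inner_single_right]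
    field_simp
    ring
  · have hn' : (2 : ℝ) - n ≠ 0 := by
      rw [sub_ne_zero]; exact_mod_cast Ne.symm h2
    refine ⟨1 / sphereArea n, fun i x hx => ?_⟩
    have hpos : 0 < ‖x‖ ^ 2 := by have : 0 < ‖x‖ := norm_pos_iff.2 hx
                                  positivity
    have hS : fundSol n =
        fun ξ => (1 / ((2 - n) * sphereArea n)) * (‖ξ‖ ^ 2) ^ ((2 - n : ℝ) / 2) := by
      funext ξ
      simp only [fundSol, if_neg h2]
      rw [← Real.rpow_natCast_mul (norm_nonneg ξ), Nat.cast_ofNat, mul_div_cancel₀ _ two_ne_zero]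
      ring
    have := (((hs x).rpow_const (p := (2 - n : ℝ) / 2) (Or.inl hpos.ne')).const_mul
      (1 / ((2 - n) * sphereArea n))).fderiv
    rw [hS]
    simp only [pderivE, this]
    have he : (2 - n : ℝ) / 2 - 1 = -(n : ℝ) / 2 := by ring
    rw [he]
    simp [EuclideanSpace.inner_single_right]
    field_simp

theorem laplacian_fundSol (hn : 2 ≤ n) :
    Set.EqOn (fun x => ∑ i, pderivE i (pderivE i (fundSol n)) x) 0 {0}ᶜ := by
  obtain ⟨c, hc⟩ := exists_pderivE_fundSol hn
  intro x hx
  have hpos : 0 < ‖x‖ ^ 2 := by have : 0 < ‖x‖ := norm_pos_iff.2 hx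
                                positivity
  have key : ∀ i : Fin n, pderivE i (pderivE i (fundSol n)) x =
      c * (‖x‖ ^ 2) ^ (-(n : ℝ) / 2 - 1) * (‖x‖ ^ 2 - n * (x i) ^ 2) := by
    intro i
    rw [(hc i).pderivE isOpen_compl_singleton i hx]
    have hp : HasFDerivAt (fun ξ : EuclideanSpace ℝ (Fin n) => ξ i)
        (EuclideanSpace.proj i : EuclideanSpace ℝ (Fin n) →L[ℝ] ℝ) x :=
      (EuclideanSpace.proj i : EuclideanSpace ℝ (Fin n) →L[ℝ] ℝ).hasFDerivAt
    have := ((hp.mul ((hasStrictFDerivAt_norm_sq x).hasFDerivAt.rpow_const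
      (p := -(n : ℝ) / 2) (Or.inl hpos.ne'))).const_mul c).fderiv
    refine (DFunLike.congr_fun this _).trans ?_
    have hr : (‖x‖ ^ 2) ^ (-(n : ℝ) / 2) = (‖x‖ ^ 2) ^ (-(n : ℝ) / 2 - 1) * ‖x‖ ^ 2 := by
      rw [Real.rpow_sub_one hpos.ne', div_mul_cancel₀ _ hpos.ne']
    simp [EuclideanSpace.inner_single_right]
    rw [hr]
    ring
  simp only [key, ← Finset.mul_sum, Finset.sum_sub_distrib, Pi.zero_apply,
    ← EuclideanSpace.real_norm_sq_eq]
  simp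

theorem laplacian_pderivE_fundSol (hn : 2 ≤ n) (j : Fin n) :
    Set.EqOn (fun x => ∑ i, pderivE i (pderivE i (pderivE j (fundSol n))) x) 0 {0}ᶜ := by
  intro x hx
  have ho : IsOpen ({0}ᶜ : Set (EuclideanSpace ℝ (Fin n))) := isOpen_compl_singleton
  have hS := contDiffOn_fundSol n
  have h1 : ∀ i, pderivE i (pderivE i (pderivE j (fundSol n))) x =
      pderivE j (pderivE i (pderivE i (fundSol n))) x := fun i => by
    rw [(pderivE_comm ho hS i j).pderivE ho i hx, pderivE_comm ho (hS.pderivE ho i) i j hx]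
  simp only [h1]
  rw [← pderivE_sum _ fun i _ => ((((hS.pderivE ho i).pderivE ho i).differentiableOn
    (by simp)).differentiableAt (ho.mem_nhds hx)), (laplacian_fundSol hn).pderivE ho j hx]
  simp [pderivE]

end FundamentalSolution

/-- the double layer potential of an integrable density is well defined,
infinitely differentiable at every point off the support of the measure, and harmonic on
the complement of the support.  Here `ν y ⬝ ∇Sₙ(x - y)` is realised as the directional
derivative `fderiv ℝ (fundSol n) (x - y) (ν y)`. -/
theorem doubleLayer_welldefined_smooth_harmonic
    (n : ℕ) (hn : 2 ≤ n)
    (σ : Measure (EuclideanSpace ℝ (Fin n))) [IsFiniteMeasure σ]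
    (hK : IsCompact (measSupport σ))
    (ν : EuclideanSpace ℝ (Fin n) → EuclideanSpace ℝ (Fin n))
    (hνmeas : Measurable ν) (hν1 : ∀ y, ‖ν y‖ ≤ 1)
    (ψ : EuclideanSpace ℝ (Fin n) → ℝ) (hψ : Integrable ψ σ) :
    (∀ x ∉ measSupport σ,
        Integrable (fun y => ψ y * fderiv ℝ (fundSol n) (x - y) (ν y)) σ ∧
        ContDiffAt ℝ (⊤ : ℕ∞)
          (fun z => -∫ y, ψ y * fderiv ℝ (fundSol n) (z - y) (ν y) ∂σ) x) ∧
    HarmonicOnSet (fun z => -∫ y, ψ y * fderiv ℝ (fundSol n) (z - y) (ν y) ∂σ)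
      (measSupport σ)ᶜ := by
  have hσ := measure_compl_measSupport σ
  set K := measSupport σ
  have ho : IsOpen ({0}ᶜ : Set (EuclideanSpace ℝ (Fin n))) := isOpen_compl_singleton
  have hKo : IsOpen Kᶜ := hK.isClosed.isOpen_compl
  have hS := contDiffOn_fundSol n
  let φ : Fin n → EuclideanSpace ℝ (Fin n) → ℝ := fun j y => -(ψ y * ν y j)
  have hφ : ∀ j, Integrable (φ j) σ := fun j => by
    refine Integrable.neg (hψ.mul_bdd (c := 1) ?_ (ae_of_all _ fun y => ?_))
    · exact ((EuclideanSpace.proj j : EuclideanSpace ℝ (Fin n) →L[ℝ] ℝ).continuous.measurable.comp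
        hνmeas).aestronglyMeasurable
    · exact (PiLp.norm_apply_le (ν y) j).trans (hν1 y)
  have hker : ∀ z y, ψ y * fderiv ℝ (fundSol n) (z - y) (ν y) =
      -∑ j, φ j y • pderivE j (fundSol n) (z - y) := fun z y => by
    rw [fderiv_apply_eq_sum_pderivE, Finset.mul_sum, ← Finset.sum_neg_distrib]
    exact Finset.sum_congr rfl fun j _ => by simp only [φ, smul_eq_mul]; ring
  have hint : ∀ z ∉ K, ∀ j,
      Integrable (fun y => φ j y • pderivE j (fundSol n) (z - y)) σ := fun z hz j =>
    integrable_potential hK hσ (hφ j) (hS.pderivE ho j).continuousOn hz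
  have hw : Set.EqOn (fun z => -∫ y, ψ y * fderiv ℝ (fundSol n) (z - y) (ν y) ∂σ)
      (fun z => ∑ j, ∫ y, φ j y • pderivE j (fundSol n) (z - y) ∂σ) Kᶜ := fun z hz => by
    simp only [hker, integral_neg, neg_neg]
    exact integral_finsetSum _ fun j _ => hint z hz j
  have hsm : ∀ {f : EuclideanSpace ℝ (Fin n) → ℝ}, ContDiffOn ℝ (⊤ : ℕ∞) f {0}ᶜ → ∀ j,
      ContDiffOn ℝ (⊤ : ℕ∞) (fun z => ∫ y, φ j y • f (z - y) ∂σ) Kᶜ := fun hf j =>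
    contDiffOn_potential hK hσ (hφ j) hf
  have hsmooth : ContDiffOn ℝ (⊤ : ℕ∞)
      (fun z => -∫ y, ψ y * fderiv ℝ (fundSol n) (z - y) (ν y) ∂σ) Kᶜ :=
    (ContDiffOn.sum fun j _ => hsm (hS.pderivE ho j) j).congr hw
  refine ⟨fun x hx => ⟨?_, hsmooth.contDiffAt (hKo.mem_nhds hx)⟩,
    hsmooth.of_le (WithTop.coe_le_coe.2 (le_top : (2 : ℕ∞) ≤ ⊤)), fun x hx => ?_⟩
  · simp only [hker]
    exact (integrable_finsetSum _ fun j _ => hint x hx j).neg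
  have hdiff : ∀ {f : EuclideanSpace ℝ (Fin n) → ℝ}, ContDiffOn ℝ (⊤ : ℕ∞) f {0}ᶜ → ∀ j,
      ∀ z ∈ Kᶜ, DifferentiableAt ℝ (fun z => ∫ y, φ j y • f (z - y) ∂σ) z := fun hf j z hz =>
    ((hsm hf j).differentiableOn (by simp)).differentiableAt (hKo.mem_nhds hz)
  have hstep : ∀ i, ∀ f : Fin n → EuclideanSpace ℝ (Fin n) → ℝ,
      (∀ j, ContDiffOn ℝ (⊤ : ℕ∞) (f j) {0}ᶜ) →
      Set.EqOn (pderivE i fun z => ∑ j, ∫ y, φ j y • f j (z - y) ∂σ)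
        (fun z => ∑ j, ∫ y, φ j y • pderivE i (f j) (z - y) ∂σ) Kᶜ := fun i f hf z hz => by
    rw [pderivE_sum _ fun j _ => hdiff (hf j) j z hz]
    exact Finset.sum_congr rfl fun j _ => pderivE_potential hK hσ (hφ j) (hf j) i hz
  have hpp : ∀ i, pderivE i (pderivE i fun z =>
      -∫ y, ψ y * fderiv ℝ (fundSol n) (z - y) (ν y) ∂σ) x =
      ∑ j, ∫ y, φ j y • pderivE i (pderivE i (pderivE j (fundSol n))) (x - y) ∂σ := fun i =>
    (((hw.pderivE hKo i).trans (hstep i _ fun j => hS.pderivE ho j)).pderivE hKo i hx).trans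
      (hstep i _ (fun j => (hS.pderivE ho j).pderivE ho i) hx)
  simp only [hpp]
  rw [Finset.sum_comm]
  refine Finset.sum_eq_zero fun j _ => ?_
  rw [← integral_finsetSum _ fun i _ => integrable_potential hK hσ (hφ j)
    (((hS.pderivE ho j).pderivE ho i).pderivE ho i).continuousOn hx]
  refine integral_eq_zero_of_ae ?_
  filter_upwards [ae_iff.2 hσ] with y hy
  have h0 : x - y ∈ ({0}ᶜ : Set (EuclideanSpace ℝ (Fin n))) := fun h =>
    hx (by rwa [sub_eq_zero.1 h])
  have := laplacian_pderivE_fundSol hn j h0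
  simp only [Pi.zero_apply] at this ⊢
  rw [← Finset.smul_sum, this, smul_zero]
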